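/- Let K>0 and let ν be a probability measure on [0,∞) with ν({0})=0 and finite mean β=∫x ν(dx). Let (ξ,μ) ≠ (0,0) be a valid initial condition and, for ε ∈ (0,1), let (ξ_ε,μ_ε) and (ξ_{−ε},μ_{−ε}) be its ε-perturbation and (−ε)-perturbation. Let x, x^ε, x^{−ε} denote the càdlàg solutions of the renewal-type integral equation with inputs h_{ξ,μ}, h_{ξ_ε,μ_ε}, h_{ξ_{−ε},μ_{−ε}}, respectively. Then for all u ≥ 0, x^{−ε}(u) ≤ x(u) ≤ x^ε(u). -/

import Mathlib

open MeasureTheory Set Filter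
open scoped ENNReal NNReal Topology

/-- Total mass `⟨1, m⟩` of a finite Borel measure on `[0,∞)` (modeled as a measure on `ℝ`). -/
noncomputable def totalMass (m : Measure ℝ) : ℝ := (m Set.univ).toReal

/-- First moment `⟨χ, m⟩ = ∫ x dm(x)` of a measure. -/
noncomputable def firstMoment (m : Measure ℝ) : ℝ := ∫ x, x ∂m

/-- The equilibrium measure `ν_e` of `ν`, defined by `ν_e([0,x]) = (1/β)∫₀ˣ ν((y,∞)) dy`
where `β` is the mean of `ν`. -/
noncomputable def eqMeasure (ν : Measure ℝ) : Measure ℝ :=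
  (ENNReal.ofReal (firstMoment ν))⁻¹ •
    ((volume.restrict (Set.Ici (0:ℝ))).withDensity fun y => ν (Set.Ioi y))

/-- The mean `β_e` of the equilibrium measure of `ν`. -/
noncomputable def meanE (ν : Measure ℝ) : ℝ := firstMoment (eqMeasure ν)

/-- `(ξ, μ)` is a valid initial condition for the fluid model with sharing limit `K` and
job-size distribution `ν`:  `ξ = (⟨1,ξ⟩+⟨1,μ⟩−K)⁺ ν` and `⟨1,μ⟩ = (⟨1,ξ⟩+⟨1,μ⟩) ∧ K`. -/
def ValidInit (K : ℝ) (ν ξ μ : Measure ℝ) : Prop :=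
  IsFiniteMeasure ξ ∧ IsFiniteMeasure μ ∧
  ξ (Set.Iio 0) = 0 ∧ μ (Set.Iio 0) = 0 ∧
  ξ = ENNReal.ofReal (max (totalMass ξ + totalMass μ - K) 0) • ν ∧
  totalMass μ = min (totalMass ξ + totalMass μ) K

/-- The lifting map `Δ_{K,ν} w = ( ((w−Kβ_e)⁺/β)·ν , ((w∧Kβ_e)/β_e)·ν_e )`. -/
noncomputable def liftMap (K : ℝ) (ν : Measure ℝ) (w : ℝ) : Measure ℝ × Measure ℝ :=
  (ENNReal.ofReal (max (w - K * meanE ν) 0 / firstMoment ν) • ν,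
   ENNReal.ofReal (min w (K * meanE ν) / meanE ν) • eqMeasure ν)

/-- A measure on `[0,∞)` is nonlattice if it is not concentrated on `{0, δ, 2δ, ...}`
for any `δ > 0`. -/
def Nonlattice (ν : Measure ℝ) : Prop :=
  ∀ δ : ℝ, 0 < δ → ν ({x : ℝ | ∃ n : ℕ, x = n * δ}ᶜ) ≠ 0

/-- The input function `h_{ξ,μ}(u) = ξ(A_u) + μ(A_u)` of the renewal-type equation. -/
noncomputable def hFun (ξ μ : Measure ℝ) (u : ℝ) : ℝ :=
  (ξ (Set.Ioi u)).toReal + (μ (Set.Ioi u)).toReal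

/-- The renewal-type integral equation
`x(u) = h(u) + ∫_{[0,u]} (x(u−v)−K)⁺ dF(v) + ∫_{[0,u]} (x(u−v) ∧ K) dF_e(v)`,
where the Lebesgue–Stieltjes integrals against the CDFs `F`, `F_e` are integrals
against the measures `ν` and `ν_e`. -/
def RenewalEqn (K : ℝ) (ν : Measure ℝ) (h x : ℝ → ℝ) : Prop :=
  ∀ u : ℝ, 0 ≤ u →
    x u = h u + (∫ v in Set.Icc 0 u, max (x (u - v) - K) 0 ∂ν)
        + ∫ v in Set.Icc 0 u, min (x (u - v)) K ∂(eqMeasure ν)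

/-- A real-valued function on `[0,∞)` that is right continuous with left limits. -/
def Cadlag (x : ℝ → ℝ) : Prop :=
  (∀ t : ℝ, 0 ≤ t → ContinuousWithinAt x (Set.Ici t) t) ∧
  (∀ t : ℝ, 0 < t → ∃ l : ℝ, Filter.Tendsto x (nhdsWithin t (Set.Iio t)) (nhds l))

/-- `x(∞) = (w − Kβ_e)⁺/β + (w ∧ Kβ_e)/β_e`, the equilibrium fluid system size
corresponding to workload `w`. -/
noncomputable def xInf (K : ℝ) (ν : Measure ℝ) (w : ℝ) : ℝ :=
  max (w - K * meanE ν) 0 / firstMoment ν + min w (K * meanE ν) / meanE ν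

open Classical in
/-- The `ε`-perturbation `(ξ_ε, μ_ε)` of a nonzero valid initial condition `(ξ, μ)`. -/
noncomputable def pertPos (K ε : ℝ) (ξ μ : Measure ℝ) : Measure ℝ × Measure ℝ :=
  if totalMass μ < K then
    (ξ + ENNReal.ofReal (max (ε - (K - totalMass μ) / totalMass μ) 0) • μ,
     ENNReal.ofReal (1 + min ((K - totalMass μ) / totalMass μ) ε) • μ)
  else if ξ = 0 then
    (ξ + ENNReal.ofReal ε • μ, μ)
  else
    (ξ + ENNReal.ofReal ε • (ξ + μ), μ)

open Classical in
/-- The `(−ε)`-perturbation `(ξ_{−ε}, μ_{−ε})` of a nonzero valid initial condition. -/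
noncomputable def pertNeg (ε : ℝ) (ξ μ : Measure ℝ) : Measure ℝ × Measure ℝ :=
  if ξ = 0 then
    (ξ, ENNReal.ofReal (1 - ε) • μ)
  else
    (ENNReal.ofReal (max (1 - ε * firstMoment (ξ + μ) / firstMoment ξ) 0) • ξ,
     ENNReal.ofReal
       (if 1 < ε * firstMoment (ξ + μ) / firstMoment ξ then
          (1 - ε) * (firstMoment (ξ + μ) / firstMoment μ)
        else 1) • μ)

namespace Cadlag

lemma continuous_comp {x : ℝ → ℝ} (hx : Cadlag x) {φ : ℝ → ℝ} (hφ : Continuous φ) :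
    Cadlag (fun t => φ (x t)) := by
  refine ⟨fun t ht => hφ.continuousAt.comp_continuousWithinAt (hx.1 t ht), fun t ht => ?_⟩
  obtain ⟨l, hl⟩ := hx.2 t ht
  exact ⟨φ l, (hφ.tendsto l).comp hl⟩

lemma sub {x y : ℝ → ℝ} (hx : Cadlag x) (hy : Cadlag y) : Cadlag (fun t => x t - y t) := by
  refine ⟨fun t ht => (hx.1 t ht).sub (hy.1 t ht), fun t ht => ?_⟩
  obtain ⟨l, hl⟩ := hx.2 t ht
  obtain ⟨m, hm⟩ := hy.2 t ht
  exact ⟨l - m, hl.sub hm⟩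

/-- A càdlàg function on `[0,∞)`, extended to the left by its value at `0`, is measurable. -/
lemma measurable_extend {x : ℝ → ℝ} (hx : Cadlag x) : Measurable (fun t => x (max t 0)) := by
  set a : ℕ → ℝ → ℝ := fun n t => ((⌊((n : ℝ) + 1) * t⌋ : ℝ) + 1) / ((n : ℝ) + 1) with ha
  have hlow : ∀ n t, t ≤ a n t := fun n t => by
    have hn : (0 : ℝ) < n + 1 := by positivity
    rw [ha, le_div_iff₀ hn]
    linarith [Int.lt_floor_add_one (((n : ℝ) + 1) * t)]
  have hupp : ∀ n t, a n t ≤ t + 1 / ((n : ℝ) + 1) := fun n t => by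
    have hn : (0 : ℝ) < n + 1 := by positivity
    rw [ha, div_le_iff₀ hn, add_mul t, one_div_mul_cancel hn.ne']
    linarith [Int.floor_le (((n : ℝ) + 1) * t)]
  refine measurable_of_tendsto_metrizable (f := fun n t => x (max (a n t) 0)) (fun n => ?_) ?_
  · have hfl : Measurable fun t : ℝ => ⌊((n : ℝ) + 1) * t⌋ :=
      Int.measurable_floor.comp (measurable_const_mul _)
    exact (measurable_from_top
      (f := fun k : ℤ => x (max (((k : ℝ) + 1) / ((n : ℝ) + 1)) 0))).comp hfl
  · rw [tendsto_pi_nhds]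
    intro t
    have hat : Tendsto (fun n => a n t) atTop (𝓝 t) := by
      refine tendsto_of_tendsto_of_tendsto_of_le_of_le tendsto_const_nhds ?_
        (fun n => hlow n t) (fun n => hupp n t)
      simpa using tendsto_const_nhds.add (tendsto_one_div_add_atTop_nhds_zero_nat (𝕜 := ℝ))
    refine (hx.1 (max t 0) (le_max_right _ _)).tendsto.comp ?_
    refine tendsto_nhdsWithin_iff.2 ⟨hat.max tendsto_const_nhds, Eventually.of_forall fun n => ?_⟩
    exact max_le_max_right 0 (hlow n t)

lemma exists_bound {x : ℝ → ℝ} (hx : Cadlag x) (T : ℝ) :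
    ∃ C, ∀ t ∈ Icc 0 T, |x t| ≤ C := by
  refine isCompact_Icc.induction_on (p := fun s => ∃ C, ∀ t ∈ s, |x t| ≤ C)
    ⟨0, by simp⟩ (fun s t hst ⟨C, hC⟩ => ⟨C, fun u hu => hC u (hst hu)⟩) ?_ ?_
  · rintro s t ⟨C, hC⟩ ⟨D, hD⟩
    refine ⟨max C D, fun u hu => ?_⟩
    rcases hu with hu | hu
    · exact (hC u hu).trans (le_max_left _ _)
    · exact (hD u hu).trans (le_max_right _ _)
  · intro t ht
    have hright : ∀ᶠ s in 𝓝[≥] t, |x s| ≤ |x t| + 1 :=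
      (hx.1 t ht.1).abs.eventually_le_const (by linarith)
    rcases ht.1.eq_or_lt with h0 | h0
    · subst h0
      exact ⟨_, mem_of_superset (nhdsWithin_mono _ Icc_subset_Ici_self hright) subset_rfl,
        |x 0| + 1, fun _ h => h⟩
    · obtain ⟨l, hl⟩ := hx.2 t h0
      have hleft : ∀ᶠ s in 𝓝[<] t, |x s| ≤ |l| + 1 :=
        hl.abs.eventually_le_const (by linarith)
      refine ⟨{s | |x s| ≤ max (|x t| + 1) (|l| + 1)}, mem_nhdsWithin_of_mem_nhds ?_,
        _, fun _ h => h⟩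
      rw [← nhdsLT_sup_nhdsGE]
      exact ⟨hleft.mono fun s hs => hs.trans (le_max_right _ _),
        hright.mono fun s hs => hs.trans (le_max_left _ _)⟩

lemma integrableOn_comp_sub {x : ℝ → ℝ} (hx : Cadlag x) {G : Measure ℝ} {u : ℝ}
    (hG : G (Icc 0 u) ≠ ∞) : IntegrableOn (fun v => x (u - v)) (Icc 0 u) G := by
  obtain ⟨C, hC⟩ := hx.exists_bound u
  have hmeas : Measurable fun v => x (max (u - v) 0) :=
    hx.measurable_extend.comp (measurable_const.sub measurable_id)
  have hbase : IntegrableOn (fun v => x (max (u - v) 0)) (Icc 0 u) G := by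
    refine Measure.integrableOn_of_bounded (M := C) hG hmeas.aestronglyMeasurable ?_
    refine (ae_restrict_iff' measurableSet_Icc).2 (Eventually.of_forall fun v hv => ?_)
    rw [Real.norm_eq_abs]
    exact hC _ ⟨le_max_right _ _, max_le (by linarith [hv.1]) (hv.1.trans hv.2)⟩
  refine hbase.congr_fun (fun v hv => ?_) measurableSet_Icc
  simp only [max_eq_left (sub_nonneg.2 hv.2)]

end Cadlag

lemma exists_measure_Icc_zero_le_half {G : Measure ℝ} (hG : ∀ u, G (Icc 0 u) ≠ ∞)
    (hG0 : G {0} = 0) : ∃ δ > 0, G.real (Icc 0 δ) ≤ 1 / 2 := by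
  have hlim : Tendsto (fun n : ℕ => G (Icc 0 (1 / ((n : ℝ) + 1)))) atTop (𝓝 0) := by
    have hInter : ⋂ n : ℕ, Icc 0 (1 / ((n : ℝ) + 1)) = {0} := by
      ext t
      simp only [mem_iInter, mem_Icc, mem_singleton_iff]
      refine ⟨fun h => le_antisymm ?_ (h 0).1, ?_⟩
      · exact ge_of_tendsto' tendsto_one_div_add_atTop_nhds_zero_nat fun n => (h n).2
      · rintro rfl n
        exact ⟨le_rfl, by positivity⟩
    rw [← hG0, ← hInter]
    refine tendsto_measure_iInter_atTop (fun n => measurableSet_Icc.nullMeasurableSet) ?_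
      ⟨0, hG _⟩
    intro m n hmn
    exact Icc_subset_Icc_right (one_div_le_one_div_of_le (by positivity) (by simpa using hmn))
  obtain ⟨n, hn⟩ :=
    (hlim.eventually_le_const (by simp : (0 : ℝ≥0∞) < ENNReal.ofReal (1 / 2))).exists
  exact ⟨1 / ((n : ℝ) + 1), by positivity, ENNReal.toReal_le_of_le_ofReal (by norm_num) hn⟩

/-- A locally bounded nonnegative function dominated by its convolution with a locally finite
measure that has no atom at `0` vanishes on `[0,∞)`. -/
lemma eq_zero_of_le_renewal_integral {G : Measure ℝ} (hG : ∀ u, G (Icc 0 u) ≠ ∞)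
    (hG0 : G {0} = 0) {g : ℝ → ℝ} (hg : ∀ u, 0 ≤ g u)
    (hbdd : ∀ T, ∃ C, ∀ t ∈ Icc 0 T, |g t| ≤ C)
    (hle : ∀ u, 0 ≤ u → g u ≤ ∫ v in Icc 0 u, g (u - v) ∂G) :
    ∀ u, 0 ≤ u → g u = 0 := by
  obtain ⟨δ, hδ, hGδ⟩ := exists_measure_Icc_zero_le_half hG hG0
  have key : ∀ n : ℕ, ∀ u ∈ Ico 0 (n * δ), g u = 0 := by
    intro n
    induction n with
    | zero => intro u hu; simp at hu
    | succ n ih =>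
      set I : Set ℝ := Ico 0 ((n + 1 : ℕ) * δ) with hI
      set C : ℝ := sSup (g '' I) with hC
      have hne : (g '' I).Nonempty :=
        ⟨g 0, 0, ⟨le_rfl, by positivity⟩, rfl⟩
      have hba : BddAbove (g '' I) := by
        obtain ⟨B, hB⟩ := hbdd ((n + 1 : ℕ) * δ)
        refine ⟨B, ?_⟩
        rintro _ ⟨t, ht, rfl⟩
        exact (le_abs_self _).trans (hB t ⟨ht.1, ht.2.le⟩)
      have hgC : ∀ t ∈ I, g t ≤ C := fun t ht => le_csSup hba ⟨t, ht, rfl⟩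
      have hC0 : 0 ≤ C := (hg 0).trans (hgC 0 ⟨le_rfl, by positivity⟩)
      have hhalf : C ≤ C / 2 := by
        refine csSup_le hne ?_
        rintro _ ⟨u, hu, rfl⟩
        have hcut : ∫ v in Icc 0 u, g (u - v) ∂G = ∫ v in Icc 0 u ∩ Icc 0 δ, g (u - v) ∂G := by
          refine (setIntegral_eq_of_subset_of_forall_sdiff_eq_zero measurableSet_Icc
            inter_subset_left fun v hv => ih _ ⟨sub_nonneg.2 hv.1.2, ?_⟩)
          have hv1 : δ < v := by
            by_contra! h
            exact hv.2 ⟨hv.1, hv.1.1, h⟩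
          have hu2 := hu.2
          push_cast at hu2
          linarith
        have hfin : G (Icc 0 u ∩ Icc 0 δ) < ∞ :=
          (measure_mono inter_subset_right).trans_lt (hG δ).lt_top
        calc g u ≤ ∫ v in Icc 0 u ∩ Icc 0 δ, g (u - v) ∂G := hcut ▸ hle u hu.1
          _ ≤ ‖∫ v in Icc 0 u ∩ Icc 0 δ, g (u - v) ∂G‖ := Real.le_norm_self _
          _ ≤ C * G.real (Icc 0 u ∩ Icc 0 δ) := by
            refine norm_setIntegral_le_of_norm_le_const hfin fun v hv => ?_
            rw [Real.norm_of_nonneg (hg _)]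
            exact hgC _ ⟨sub_nonneg.2 hv.1.2, by linarith [hu.2, hv.1.1]⟩
          _ ≤ C * (1 / 2) :=
            mul_le_mul_of_nonneg_left
              ((measureReal_mono inter_subset_right (hG δ)).trans hGδ) hC0
          _ = C / 2 := by ring
      intro u hu
      exact le_antisymm ((hgC u hu).trans (by linarith)) (hg u)
  intro u hu
  obtain ⟨n, hn⟩ := exists_nat_gt (u / δ)
  exact key n u ⟨hu, (div_lt_iff₀ hδ).1 hn⟩

lemma firstMoment_pos {ν : Measure ℝ} [IsProbabilityMeasure ν] (hνsupp : ν (Iio 0) = 0)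
    (hν0 : ν {0} = 0) (hνmean : Integrable (fun x => x) ν) : 0 < firstMoment ν := by
  have hnonneg : 0 ≤ᵐ[ν] fun x => x := by
    rw [EventuallyLE, ae_iff]
    simpa [Iio_def] using hνsupp
  rw [firstMoment, integral_pos_iff_support_of_nonneg_ae hnonneg hνmean]
  have hsupp : Function.support (fun x : ℝ => x) = {0}ᶜ := by
    ext t
    simp
  rw [hsupp, prob_compl_eq_one_sub (measurableSet_singleton 0), hν0]
  simp

lemma eqMeasure_Icc_ne_top {ν : Measure ℝ} [IsProbabilityMeasure ν] (hβ : 0 < firstMoment ν)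
    (u : ℝ) : eqMeasure ν (Icc 0 u) ≠ ∞ := by
  rw [eqMeasure, Measure.smul_apply, smul_eq_mul]
  refine ENNReal.mul_ne_top (by simpa using hβ) ?_
  rw [withDensity_apply _ measurableSet_Icc]
  refine ((lintegral_mono fun y => prob_le_one).trans_lt ?_).ne
  simp only [lintegral_const, one_mul, Measure.restrict_apply_univ]
  exact (Measure.restrict_apply_le _ _).trans_lt measure_Icc_lt_top

lemma eqMeasure_singleton (ν : Measure ℝ) (t : ℝ) : eqMeasure ν {t} = 0 := by
  have h : eqMeasure ν ≪ volume :=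
    ((withDensity_absolutelyContinuous _ _).trans
      Measure.restrict_le_self.absolutelyContinuous).smul_left _
  exact h (by simp)

/-- Càdlàg solutions of the renewal-type equation are monotone in the input. -/
lemma RenewalEqn.mono {K : ℝ} {ν : Measure ℝ} [IsProbabilityMeasure ν]
    (hβ : 0 < firstMoment ν) (hν0 : ν {0} = 0) {h₁ h₂ x₁ x₂ : ℝ → ℝ}
    (hc₁ : Cadlag x₁) (hx₁ : RenewalEqn K ν h₁ x₁) (hc₂ : Cadlag x₂) (hx₂ : RenewalEqn K ν h₂ x₂)
    (hle : ∀ u, h₁ u ≤ h₂ u) : ∀ u, 0 ≤ u → x₁ u ≤ x₂ u := by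
  have hν : ∀ u, ν (Icc 0 u) ≠ ∞ := fun u => measure_ne_top _ _
  have hνe := eqMeasure_Icc_ne_top hβ
  have hφ : Continuous fun t : ℝ => max (t - K) 0 := by fun_prop
  have hψ : Continuous fun t : ℝ => min t K := by fun_prop
  have hcg : Cadlag fun t => max (x₁ t - x₂ t) 0 :=
    (hc₁.sub hc₂).continuous_comp (φ := fun t => max t 0) (by fun_prop)
  have hzero := eq_zero_of_le_renewal_integral (G := ν + eqMeasure ν)
    (g := fun t => max (x₁ t - x₂ t) 0)
    (fun u => by simpa using hνe u) (by simp [hν0, eqMeasure_singleton])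
    (fun u => le_max_right _ _) hcg.exists_bound ?_
  · intro u hu
    have := hzero u hu
    simp only [max_eq_right_iff] at this
    linarith
  intro u hu
  have hgν := hcg.integrableOn_comp_sub (hν u)
  have hge := hcg.integrableOn_comp_sub (hνe u)
  rw [Measure.restrict_add, integral_add_measure hgν hge]
  have h1 : ∫ v in Icc 0 u, max (x₁ (u - v) - K) 0 ∂ν ≤
      (∫ v in Icc 0 u, max (x₂ (u - v) - K) 0 ∂ν) +
        ∫ v in Icc 0 u, max (x₁ (u - v) - x₂ (u - v)) 0 ∂ν := by
    have hi₂ := (hc₂.continuous_comp hφ).integrableOn_comp_sub (hν u)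
    rw [← integral_add hi₂ hgν]
    refine integral_mono ((hc₁.continuous_comp hφ).integrableOn_comp_sub (hν u))
      (hi₂.add hgν) fun v => ?_
    dsimp only
    grind
  have h2 : ∫ v in Icc 0 u, min (x₁ (u - v)) K ∂(eqMeasure ν) ≤
      (∫ v in Icc 0 u, min (x₂ (u - v)) K ∂(eqMeasure ν)) +
        ∫ v in Icc 0 u, max (x₁ (u - v) - x₂ (u - v)) 0 ∂(eqMeasure ν) := by
    have hi₂ := (hc₂.continuous_comp hψ).integrableOn_comp_sub (hνe u)
    rw [← integral_add hi₂ hge]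
    refine integral_mono ((hc₁.continuous_comp hψ).integrableOn_comp_sub (hνe u))
      (hi₂.add hge) fun v => ?_
    dsimp only
    grind
  refine max_le ?_ (add_nonneg (integral_nonneg fun v => le_max_right _ _)
    (integral_nonneg fun v => le_max_right _ _))
  rw [hx₁ u hu, hx₂ u hu]
  linarith [hle u]

lemma hFun_mono {ξ₁ μ₁ ξ₂ μ₂ : Measure ℝ} [IsFiniteMeasure ξ₂] [IsFiniteMeasure μ₂]
    (hξ : ξ₁ ≤ ξ₂) (hμ : μ₁ ≤ μ₂) (u : ℝ) : hFun ξ₁ μ₁ u ≤ hFun ξ₂ μ₂ u :=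
  add_le_add (ENNReal.toReal_mono (measure_ne_top _ _) (hξ _))
    (ENNReal.toReal_mono (measure_ne_top _ _) (hμ _))

lemma ofReal_smul_measure_le {c : ℝ} (hc : c ≤ 1) (m : Measure ℝ) : ENNReal.ofReal c • m ≤ m :=
  fun s => by
    simpa using mul_le_mul_left (ENNReal.ofReal_le_one.2 hc) (m s)

lemma le_ofReal_smul_measure {c : ℝ} (hc : 1 ≤ c) (m : Measure ℝ) : m ≤ ENNReal.ofReal c • m :=
  fun s => by
    simpa using mul_le_mul_left (ENNReal.one_le_ofReal.2 hc) (m s)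

lemma isFiniteMeasure_pertPos (K ε : ℝ) (ξ μ : Measure ℝ) [IsFiniteMeasure ξ]
    [IsFiniteMeasure μ] :
    IsFiniteMeasure (pertPos K ε ξ μ).1 ∧ IsFiniteMeasure (pertPos K ε ξ μ).2 := by
  have : ∀ (c : ℝ) (m : Measure ℝ) [IsFiniteMeasure m],
      IsFiniteMeasure (ENNReal.ofReal c • m) :=
    fun c m _ => m.smul_finite ENNReal.ofReal_ne_top
  unfold pertPos
  split_ifs <;> exact ⟨inferInstance, inferInstance⟩

lemma le_pertPos {K ε : ℝ} (hε : 0 < ε) (ξ μ : Measure ℝ) :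
    ξ ≤ (pertPos K ε ξ μ).1 ∧ μ ≤ (pertPos K ε ξ μ).2 := by
  unfold pertPos
  split_ifs with hK
  · refine ⟨Measure.le_add_right le_rfl, le_ofReal_smul_measure ?_ μ⟩
    have hm : 0 ≤ totalMass μ := ENNReal.toReal_nonneg
    have : 0 ≤ (K - totalMass μ) / totalMass μ := div_nonneg (sub_nonneg.2 hK.le) hm
    linarith [le_min this hε.le]
  · exact ⟨Measure.le_add_right le_rfl, le_rfl⟩
  · exact ⟨Measure.le_add_right le_rfl, le_rfl⟩

lemma pertNeg_le {ε : ℝ} (hε : ε ∈ Ioo (0 : ℝ) 1) {ξ μ : Measure ℝ} (hξ : Integrable (fun x => x) ξ)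
    (hξ0 : ξ ≠ 0 → 0 < firstMoment ξ) (hμ0 : μ (Iio 0) = 0) :
    (pertNeg ε ξ μ).1 ≤ ξ ∧ (pertNeg ε ξ μ).2 ≤ μ := by
  have hM : 0 ≤ firstMoment μ := by
    refine integral_nonneg_of_ae ?_
    rw [EventuallyLE, ae_iff]
    simpa [Iio_def] using hμ0
  unfold pertNeg
  by_cases h0 : ξ = 0
  · rw [if_pos h0]
    exact ⟨le_rfl, ofReal_smul_measure_le (by linarith [hε.1]) μ⟩
  have hX := hξ0 h0
  have hsum : firstMoment (ξ + μ) = 0 ∨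
      firstMoment (ξ + μ) = firstMoment ξ + firstMoment μ := by
    by_cases hμ : Integrable (fun x => x) μ
    · exact .inr (integral_add_measure hξ hμ)
    · exact .inl (integral_undef fun h => hμ h.right_of_add_measure)
  have hS : 0 ≤ firstMoment (ξ + μ) := by
    rcases hsum with h | h <;> rw [h]
    positivity
  rw [if_neg h0]
  refine ⟨ofReal_smul_measure_le (max_le ?_ zero_le_one) ξ, ofReal_smul_measure_le ?_ μ⟩
  · linarith [div_nonneg (mul_nonneg hε.1.le hS) hX.le]
  split_ifs with h1
  · rw [one_lt_div hX] at h1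
    rw [← mul_div_assoc]
    refine div_le_one_of_le₀ ?_ hM
    rcases hsum with h | h
    · rw [h]
      simpa using hM
    · rw [h] at h1 ⊢
      linarith
  · exact le_rfl

/-- **Comparison with perturbed initial conditions** (Lemma 3.1): the solution of the
renewal-type equation for the `(−ε)`-perturbed initial condition lies below the original
solution, which lies below the solution for the `ε`-perturbed initial condition. -/
theorem renewal_solution_perturbation_comparison
    (K : ℝ) (hK : 0 < K)
    (ν : Measure ℝ) [IsProbabilityMeasure ν]
    (hνsupp : ν (Set.Iio 0) = 0) (hν0 : ν ({0} : Set ℝ) = 0)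
    (hνmean : Integrable (fun x => x) ν)
    (ξ μ : Measure ℝ) (hvalid : ValidInit K ν ξ μ) (hne : ¬(ξ = 0 ∧ μ = 0))
    (ε : ℝ) (hε : ε ∈ Set.Ioo (0:ℝ) 1)
    (x xp xm : ℝ → ℝ)
    (hxc : Cadlag x) (hx : RenewalEqn K ν (hFun ξ μ) x)
    (hxpc : Cadlag xp)
    (hxp : RenewalEqn K ν (hFun (pertPos K ε ξ μ).1 (pertPos K ε ξ μ).2) xp)
    (hxmc : Cadlag xm)
    (hxm : RenewalEqn K ν (hFun (pertNeg ε ξ μ).1 (pertNeg ε ξ μ).2) xm) :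
    ∀ u : ℝ, 0 ≤ u → xm u ≤ x u ∧ x u ≤ xp u := by
  obtain ⟨hξf, hμf, -, hμ0, hξν, -⟩ := hvalid
  have hβ := firstMoment_pos hνsupp hν0 hνmean
  set c : ℝ≥0∞ := ENNReal.ofReal (max (totalMass ξ + totalMass μ - K) 0) with hc
  have hctop : c ≠ ∞ := ENNReal.ofReal_ne_top
  have hξint : Integrable (fun x => x) ξ := by
    rw [hξν]
    exact hνmean.smul_measure hctop
  have hξpos : ξ ≠ 0 → 0 < firstMoment ξ := by
    intro h
    have hc0 : c ≠ 0 := fun h0 => h (by rw [hξν, h0, zero_smul])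
    rw [hξν, firstMoment, integral_smul_measure, smul_eq_mul]
    exact mul_pos (ENNReal.toReal_pos hc0 hctop) hβ
  obtain ⟨hpf₁, hpf₂⟩ := isFiniteMeasure_pertPos K ε ξ μ
  obtain ⟨hp₁, hp₂⟩ := le_pertPos (K := K) hε.1 ξ μ
  obtain ⟨hm₁, hm₂⟩ := pertNeg_le hε hξint hξpos hμ0
  exact fun u hu => ⟨RenewalEqn.mono hβ hν0 hxmc hxm hxc hx (hFun_mono hm₁ hm₂) u hu,
    RenewalEqn.mono hβ hν0 hxc hx hxpc hxp (hFun_mono hp₁ hp₂) u hu⟩
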